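/- arXiv:1312.1394 — 2 statements merged into one kernel-verified Lean document; each statement's English description precedes it below -/
import Mathlib

section
/- Fix a price p ∈ ℝ, a bound ȳ > 0, and an integer k ≥ 0. Let the consumer's satisfaction function be the polynomial f(y) = Σ_{j=0}^{k} α*_j y^{j+1} with true coefficient vector α* ∈ ℝ^{k+1}. Suppose that for each i ∈ {0, …, k} the leader issues a quadratic incentive γ^(i)(y) = ξ₁^(i) y + ξ₂^(i) y² and observes a response y^(i) ∈ (0, ȳ) satisfying the first-order stationarity condition −p + ξ₁^(i) + 2ξ₂^(i) y^(i) + Σ_{j=0}^{k} (j+1) α*_j (y^(i))^j = 0. Let Y ∈ ℝ^{(k+1)×(k+1)} be the matrix with entries Y_{ij} = (j+1)(y^(i))^j and let b ∈ ℝ^{k+1} have entries b_i = p − ξ₁^(i) − 2ξ₂^(i) y^(i). If Y has rank k+1, then α* is the unique solution of Y α = b; that is, after k+1 observations the satisfaction function f is known exactly. Moreover, if y^d ∈ (0, ȳ) and v^d ∈ ℝ are given, and γ(y) = ξ₁ y + ξ₂ y² satisfies −p + ξ₁ + 2ξ₂ y^d + Σ_{j=0}^{k} (j+1) α*_j (y^d)^j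 = 0 and γ(y^d) = v^d, and the map y ↦ −p y + γ(y) + f(y) is strictly concave on ℝ, then y^d is the unique maximizer over [0, ȳ] of the consumer's objective −p y + γ(y) + f(y), and the incentive paid at the induced response is v^d. -/
theorem Matrix.mulVec_injective_of_rank_eq_card {n K : Type*} [Fintype n] [Field K]
    {A : Matrix n n K} (h : A.rank = Fintype.card n) : Function.Injective A.mulVec := by
  have htop : LinearMap.range A.mulVecLin = ⊤ :=
    Submodule.eq_top_of_finrank_eq (by rw [Module.finrank_fintype_fun_eq_card]; exact h)
  exact LinearMap.injective_iff_surjective.mpr (LinearMap.range_eq_top.mp htop)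

theorem StrictConcaveOn.lt_of_hasDerivAt_eq_zero {s : Set ℝ} {f : ℝ → ℝ} {x y : ℝ}
    (hf : StrictConcaveOn ℝ s f) (hx : x ∈ s) (hy : y ∈ s) (hxy : y ≠ x)
    (hf' : HasDerivAt f 0 x) : f y < f x := by
  rcases lt_or_gt_of_ne hxy with h | h
  · have := hf.lt_slope_of_hasDerivAt hy hx h hf'
    rw [slope_def_field, div_pos_iff_of_pos_right (sub_pos.mpr h)] at this
    linarith
  · have := hf.slope_lt_of_hasDerivAt hx hy h hf'
    rw [slope_def_field, div_neg_iff] at this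
    rcases this with ⟨_, h'⟩ | ⟨h', _⟩ <;> linarith

theorem hasDerivAt_sum_mul_pow_succ (n : ℕ) (a : Fin n → ℝ) (x : ℝ) :
    HasDerivAt (fun y : ℝ => ∑ j : Fin n, a j * y ^ ((j : ℕ) + 1))
      (∑ j : Fin n, ((j : ℕ) + 1) * a j * x ^ (j : ℕ)) x := by
  refine HasDerivAt.fun_sum fun j _ => ?_
  refine ((hasDerivAt_pow ((j : ℕ) + 1) x).const_mul (a j)).congr_deriv ?_
  rw [Nat.add_sub_cancel]
  push_cast
  ring

/-- Proposition 1: exact utility learning after `k+1` interior observations satisfying the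
first-order stationarity conditions, and the designed quadratic incentive induces the
desired consumption `y^d` at incentive cost `v^d`. -/
theorem stmt_1 (p ybar : ℝ) (hybar : 0 < ybar) (k : ℕ)
    (αstar : Fin (k + 1) → ℝ)       -- true coefficients of f(y) = ∑ α*_j y^{j+1}
    (ξ1 ξ2 : Fin (k + 1) → ℝ)       -- incentives γ^(i)(y) = ξ1 i * y + ξ2 i * y²
    (yobs : Fin (k + 1) → ℝ)        -- observed responses
    (hyobs : ∀ i, yobs i ∈ Set.Ioo (0 : ℝ) ybar)
    (hstat : ∀ i, -p + ξ1 i + 2 * ξ2 i * yobs i +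
      ∑ j : Fin (k + 1), ((j : ℕ) + 1) * αstar j * yobs i ^ (j : ℕ) = 0)
    (Y : Matrix (Fin (k + 1)) (Fin (k + 1)) ℝ)
    (hY : ∀ i j, Y i j = ((j : ℕ) + 1) * yobs i ^ (j : ℕ))
    (b : Fin (k + 1) → ℝ)
    (hb : ∀ i, b i = p - ξ1 i - 2 * ξ2 i * yobs i)
    (hrank : Y.rank = k + 1)
    -- the incentive design data
    (yd vd : ℝ) (hyd : yd ∈ Set.Ioo (0 : ℝ) ybar)
    (ξ1d ξ2d : ℝ)
    (hstatd : -p + ξ1d + 2 * ξ2d * yd +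
      ∑ j : Fin (k + 1), ((j : ℕ) + 1) * αstar j * yd ^ (j : ℕ) = 0)
    (hvd : ξ1d * yd + ξ2d * yd ^ 2 = vd)
    (hconc : StrictConcaveOn ℝ Set.univ
      (fun y : ℝ => -p * y + (ξ1d * y + ξ2d * y ^ 2) +
        ∑ j : Fin (k + 1), αstar j * y ^ ((j : ℕ) + 1))) :
    -- α* is the unique solution of Y α = b
    (Y.mulVec αstar = b ∧ ∀ α : Fin (k + 1) → ℝ, Y.mulVec α = b → α = αstar) ∧
    -- y^d is the unique maximizer of the consumer's objective over [0, ȳ]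
    (∀ y ∈ Set.Icc (0 : ℝ) ybar, y ≠ yd →
      -p * y + (ξ1d * y + ξ2d * y ^ 2) +
          ∑ j : Fin (k + 1), αstar j * y ^ ((j : ℕ) + 1) <
        -p * yd + (ξ1d * yd + ξ2d * yd ^ 2) +
          ∑ j : Fin (k + 1), αstar j * yd ^ ((j : ℕ) + 1)) ∧
    -- the incentive paid at the induced response is v^d
    ξ1d * yd + ξ2d * yd ^ 2 = vd := by
  have hsol : Y.mulVec αstar = b := by
    ext i
    have hsum : Y.mulVec αstar i =
        ∑ j : Fin (k + 1), ((j : ℕ) + 1) * αstar j * yobs i ^ (j : ℕ) := by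
      simp only [Matrix.mulVec, dotProduct, hY]
      refine Finset.sum_congr rfl fun j _ => ?_
      ring
    rw [hsum, hb]
    linarith [hstat i]
  refine ⟨⟨hsol, fun α hα => ?_⟩, fun y _ hne => ?_, hvd⟩
  · exact Matrix.mulVec_injective_of_rank_eq_card (by simpa using hrank) (hα.trans hsol.symm)
  · refine hconc.lt_of_hasDerivAt_eq_zero (Set.mem_univ yd) (Set.mem_univ y) hne ?_
    have hlin : HasDerivAt (fun y : ℝ => -p * y + (ξ1d * y + ξ2d * y ^ 2))
        (-p + ξ1d + 2 * ξ2d * yd) yd := by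
      refine (((hasDerivAt_id' yd).const_mul (-p)).fun_add
        (((hasDerivAt_id' yd).const_mul ξ1d).fun_add
          ((hasDerivAt_pow 2 yd).const_mul ξ2d))).congr_deriv ?_
      norm_num
      ring
    simpa only [hstatd] using hlin.fun_add (hasDerivAt_sum_mul_pow_succ (k + 1) αstar yd)
end

section
/- Fix a price p ∈ ℝ, a bound ȳ > 0, and a number of devices D ≥ 1. For each device ℓ ∈ {1, …, D}, let the device-level satisfaction function be the polynomial f_ℓ(y) = Σ_{j=0}^{k_ℓ} α*_{j,ℓ} y^{j+1} with coefficient vector α*_ℓ ∈ ℝ^{k_ℓ+1}, and set k* = max_{ℓ} k_ℓ. Suppose that for each device ℓ and each i ∈ {0, …, k_ℓ}, a quadratic incentive γ_ℓ^(i)(y) = ξ_{1,ℓ}^(i) y + ξ_{2,ℓ}^(i) y² is issued and a device-level response y_ℓ^(i) ∈ (0, ȳ) is observed satisfying −p + ξ_{1,ℓ}^(i) + 2ξ_{2,ℓ}^(i) y_ℓ^(i) + Σ_{j=0}^{k_ℓ} (j+1) α*_{j,ℓ} (y_ℓ^(i))^j = 0, and that the matrix Y_ℓ with entries (Y_ℓ)_{ij}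 = (j+1)(y_ℓ^(i))^j has rank k_ℓ+1. Then after k* iterations every coefficient vector α*_ℓ is uniquely determined, i.e., each device-level satisfaction function is known exactly. Moreover, if for each ℓ a desired pair (v_ℓ^d, y_ℓ^d) with y_ℓ^d ∈ (0, ȳ) is given and γ_ℓ(y) = ξ_{1,ℓ} y + ξ_{2,ℓ} y² satisfies −p + ξ_{1,ℓ} + 2ξ_{2,ℓ} y_ℓ^d + f_ℓ'(y_ℓ^d) = 0 and γ_ℓ(y_ℓ^d) = v_ℓ^d, and each map y ↦ −p y + γ_ℓ(y) + f_ℓ(y) is strictly concave, then the profile (y_1^d, …, y_D^d) is the unique maximizer over [0, ȳ]^D of the separable consumer objective J_F = Σ_{ℓ=1}^{D} (−p y_ℓ + γ_ℓ(y_ℓ) + f_ℓ(y_ℓ)). -/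
/-- A critical point of a strictly concave function on the line is its unique maximizer. -/
theorem StrictConcaveOn.lt_of_hasDerivAt_zero {g : ℝ → ℝ} (hg : StrictConcaveOn ℝ Set.univ g)
    {x y : ℝ} (hx : HasDerivAt g 0 x) (hne : y ≠ x) : g y < g x := by
  rcases lt_or_gt_of_ne hne with h | h
  · have hs := hg.lt_slope_of_hasDerivAt (Set.mem_univ y) (Set.mem_univ x) h hx
    rw [slope_def_field, lt_div_iff₀ (sub_pos.2 h)] at hs
    linarith
  · have hs := hg.slope_lt_of_hasDerivAt (Set.mem_univ x) (Set.mem_univ y) h hx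
    rw [slope_def_field, div_lt_iff₀ (sub_pos.2 h)] at hs
    linarith

theorem Matrix.mulVec_injective_of_rank_eq {n : ℕ} {A : Matrix (Fin n) (Fin n) ℝ}
    (h : A.rank = n) : Function.Injective A.mulVec := by
  rw [Matrix.mulVec_injective_iff, linearIndependent_iff_card_eq_finrank_span,
    Fintype.card_fin, Set.finrank, ← Matrix.rank_eq_finrank_span_cols, h]

/-- Derivative of a linear-quadratic payoff plus a polynomial without constant term. -/
theorem hasDerivAt_payoff (p a b : ℝ) {n : ℕ} (c : Fin n → ℝ) (x : ℝ) :
    HasDerivAt (fun y : ℝ => -p * y + (a * y + b * y ^ 2) + ∑ j : Fin n, c j * y ^ ((j : ℕ) + 1))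
      (-p + a + 2 * b * x + ∑ j : Fin n, ((j : ℕ) + 1) * c j * x ^ (j : ℕ)) x := by
  have h1 := (((hasDerivAt_id' x).const_mul (-p)).fun_add
    (((hasDerivAt_id' x).const_mul a).fun_add ((hasDerivAt_pow 2 x).const_mul b)))
  have h2 := HasDerivAt.fun_sum (u := Finset.univ) fun (j : Fin n) _ =>
    (hasDerivAt_pow ((j : ℕ) + 1) x).const_mul (c j)
  refine (h1.fun_add h2).congr_deriv ?_
  congr 1
  · norm_num
    ring
  · refine Finset.sum_congr rfl fun j _ => ?_
    push_cast
    ring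

/-- Proposition 3 (device level, exact disaggregation): with `k_ℓ + 1` interior observations
per device satisfying the first-order conditions and full-rank regression matrices, after
`k* = max_ℓ k_ℓ` iterations every device-level coefficient vector is uniquely determined;
moreover the designed device-level incentives induce the desired profile `(y_1^d, …, y_D^d)`
as the unique maximizer of the separable consumer objective over `[0, ȳ]^D`. -/
theorem stmt_3 (p ybar : ℝ) (hybar : 0 < ybar) (D : ℕ) (hD : 1 ≤ D)
    (k : Fin D → ℕ) (kstar : ℕ)
    (hkstar : ∀ ℓ, k ℓ ≤ kstar) (hkstar' : ∃ ℓ, k ℓ = kstar)   -- k* = max_ℓ k_ℓ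
    (αstar : (ℓ : Fin D) → Fin (k ℓ + 1) → ℝ)   -- true coefficients of f_ℓ
    (ξ1 ξ2 : (ℓ : Fin D) → Fin (k ℓ + 1) → ℝ)   -- incentives γ_ℓ^(i)(y) = ξ1 ℓ i y + ξ2 ℓ i y²
    (yobs : (ℓ : Fin D) → Fin (k ℓ + 1) → ℝ)    -- disaggregated device-level responses
    (hyobs : ∀ ℓ i, yobs ℓ i ∈ Set.Ioo (0 : ℝ) ybar)
    (hstat : ∀ ℓ i, -p + ξ1 ℓ i + 2 * ξ2 ℓ i * yobs ℓ i +
      ∑ j : Fin (k ℓ + 1), ((j : ℕ) + 1) * αstar ℓ j * yobs ℓ i ^ (j : ℕ) = 0)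
    (Y : (ℓ : Fin D) → Matrix (Fin (k ℓ + 1)) (Fin (k ℓ + 1)) ℝ)
    (hY : ∀ ℓ i j, Y ℓ i j = ((j : ℕ) + 1) * yobs ℓ i ^ (j : ℕ))
    (hrank : ∀ ℓ, (Y ℓ).rank = k ℓ + 1)
    -- the incentive design data
    (yd vd : Fin D → ℝ) (hyd : ∀ ℓ, yd ℓ ∈ Set.Ioo (0 : ℝ) ybar)
    (ξ1d ξ2d : Fin D → ℝ)
    (hstatd : ∀ ℓ, -p + ξ1d ℓ + 2 * ξ2d ℓ * yd ℓ +
      ∑ j : Fin (k ℓ + 1), ((j : ℕ) + 1) * αstar ℓ j * yd ℓ ^ (j : ℕ) = 0)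
    (hvd : ∀ ℓ, ξ1d ℓ * yd ℓ + ξ2d ℓ * yd ℓ ^ 2 = vd ℓ)
    (hconc : ∀ ℓ, StrictConcaveOn ℝ Set.univ
      (fun y : ℝ => -p * y + (ξ1d ℓ * y + ξ2d ℓ * y ^ 2) +
        ∑ j : Fin (k ℓ + 1), αstar ℓ j * y ^ ((j : ℕ) + 1))) :
    -- each device-level coefficient vector is uniquely determined by the data
    (∀ ℓ, ∀ α : Fin (k ℓ + 1) → ℝ,
      (∀ i, -p + ξ1 ℓ i + 2 * ξ2 ℓ i * yobs ℓ i +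
        ∑ j : Fin (k ℓ + 1), ((j : ℕ) + 1) * α j * yobs ℓ i ^ (j : ℕ) = 0) →
      α = αstar ℓ) ∧
    -- (y_1^d, …, y_D^d) is the unique maximizer of the separable objective over [0, ȳ]^D
    (∀ y : Fin D → ℝ, (∀ ℓ, y ℓ ∈ Set.Icc (0 : ℝ) ybar) → y ≠ yd →
      ∑ ℓ : Fin D, (-p * y ℓ + (ξ1d ℓ * y ℓ + ξ2d ℓ * y ℓ ^ 2) +
          ∑ j : Fin (k ℓ + 1), αstar ℓ j * y ℓ ^ ((j : ℕ) + 1)) <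
        ∑ ℓ : Fin D, (-p * yd ℓ + (ξ1d ℓ * yd ℓ + ξ2d ℓ * yd ℓ ^ 2) +
          ∑ j : Fin (k ℓ + 1), αstar ℓ j * yd ℓ ^ ((j : ℕ) + 1))) := by
  refine ⟨fun ℓ α hα => Matrix.mulVec_injective_of_rank_eq (hrank ℓ) ?_, fun y _ hne => ?_⟩
  · have key (β : Fin (k ℓ + 1) → ℝ) (i) : (Y ℓ).mulVec β i =
        ∑ j : Fin (k ℓ + 1), ((j : ℕ) + 1) * β j * yobs ℓ i ^ (j : ℕ) := by
      rw [Matrix.mulVec_eq_sum, Finset.sum_apply]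
      refine Finset.sum_congr rfl fun j _ => ?_
      simp only [Pi.smul_apply, Matrix.transpose_apply, MulOpposite.smul_eq_mul_unop, MulOpposite.unop_op, hY]
      ring
    funext i
    rw [key, key]
    linarith [hα i, hstat ℓ i]
  · have key (ℓ) (h : y ℓ ≠ yd ℓ) := (hconc ℓ).lt_of_hasDerivAt_zero
      ((hasDerivAt_payoff p (ξ1d ℓ) (ξ2d ℓ) (αstar ℓ) (yd ℓ)).congr_deriv (hstatd ℓ)) h
    obtain ⟨m, hm⟩ := Function.ne_iff.1 hne
    refine Finset.sum_lt_sum (fun ℓ _ => ?_) ⟨m, Finset.mem_univ m, key m hm⟩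
    by_cases h : y ℓ = yd ℓ
    · rw [h]
    · exact (key ℓ h).le
end
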